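/- arXiv:2511.06089 — 4 statements merged into one kernel-verified Lean document; each statement's English description precedes it below -/
import Mathlib

section
/- Let H₀, H₁, H₂ be n×n complex matrices and for l = 0,1,2 let σ_{l,1} ≥ σ_{l,2} ≥ … ≥ σ_{l,n} ≥ 0 denote the singular values of H_l in decreasing order. Then for all n×n unitary matrices Φ₁, Φ₂, the squared Frobenius norm of the cascaded matrix H₂ Φ₂ H₁ Φ₁ H₀ satisfies Tr((H₂Φ₂H₁Φ₁H₀)(H₂Φ₂H₁Φ₁H₀)ᴴ) ≤ Σ_{k=1}^{n} σ_{0,k}² σ_{1,k}² σ_{2,k}². (This is the paper's two-RIS Von Neumann-type bound, inequality (13).) -/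
open ComplexOrder

/-- Summation by parts: weighting by a nonnegative antitone sequence preserves inequalities between
all initial partial sums. -/
theorem sum_mul_le_sum_mul_of_antitone {n : ℕ} (x c b : Fin n → ℝ)
    (hx : Antitone x) (hx0 : ∀ i, 0 ≤ x i)
    (h : ∀ p : ℕ, ∑ i : Fin n, (if (i : ℕ) < p then c i else 0)
      ≤ ∑ i : Fin n, (if (i : ℕ) < p then b i else 0)) :
    ∑ i, x i * c i ≤ ∑ i, x i * b i := by
  induction n with
  | zero => simp
  | succ n ih =>
    have key := ih (fun i => x i.castSucc - x (Fin.last n)) (fun i => c i.castSucc)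
      (fun i => b i.castSucc)
      (fun i j hij => sub_le_sub_right (hx (Fin.castSucc_le_castSucc_iff.2 hij)) _)
      (fun i => sub_nonneg.2 (hx (Fin.le_last _)))
      (fun p => by
        have h' := h (min p n)
        have hlt (i : Fin n) : ((i : ℕ) < min p n) = ((i : ℕ) < p) := by
          simp [i.is_lt]
        simpa [Fin.sum_univ_castSucc, hlt] using h')
    have total : ∑ i, c i ≤ ∑ i, b i := by simpa only [Fin.is_lt, if_true] using h (n + 1)
    simp only [sub_mul, Finset.sum_sub_distrib, ← Finset.mul_sum] at key
    simp only [Fin.sum_univ_castSucc] at total ⊢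
    nlinarith [mul_le_mul_of_nonneg_left total (hx0 (Fin.last n))]

/-- A nonnegative array whose initial row sums and column sums are dominated by those of `z`
satisfies a trilinear rearrangement inequality. -/
theorem sum_sum_mul_le_of_partial_sums_le {n : ℕ} (a : Fin n → Fin n → ℝ) (x y z : Fin n → ℝ)
    (ha : ∀ i j, 0 ≤ a i j) (hx : Antitone x) (hx0 : ∀ i, 0 ≤ x i)
    (hy : Antitone y) (hy0 : ∀ i, 0 ≤ y i)
    (hrow : ∀ p : ℕ, ∑ i : Fin n, (if (i : ℕ) < p then ∑ j, a i j else 0)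
      ≤ ∑ i : Fin n, (if (i : ℕ) < p then z i else 0))
    (hcol : ∀ p : ℕ, ∑ j : Fin n, (if (j : ℕ) < p then ∑ i, a i j else 0)
      ≤ ∑ j : Fin n, (if (j : ℕ) < p then z j else 0)) :
    ∑ i, ∑ j, x i * y j * a i j ≤ ∑ k, x k * y k * z k := by
  have outer := sum_mul_le_sum_mul_of_antitone x (fun i => ∑ j, y j * a i j) (fun i => y i * z i)
    hx hx0 fun p => by
      have inner := sum_mul_le_sum_mul_of_antitone y
        (fun j => ∑ i : Fin n, if (i : ℕ) < p then a i j else 0)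
        (fun j => if (j : ℕ) < p then z j else 0) hy hy0 fun q => by
          rcases le_total p q with hpq | hqp
          · calc
              _ ≤ ∑ j, ∑ i : Fin n, (if (i : ℕ) < p then a i j else 0) := by
                refine Finset.sum_le_sum fun j _ => ?_
                split_ifs
                · exact le_rfl
                · exact Finset.sum_nonneg fun i _ => by split_ifs <;> simp [ha]
              _ = ∑ i : Fin n, (if (i : ℕ) < p then ∑ j, a i j else 0) := by
                rw [Finset.sum_comm]
                refine Finset.sum_congr rfl fun i _ => ?_
                split_ifs <;> simp
              _ ≤ _ := hrow p
              _ = _ := by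
                refine Finset.sum_congr rfl fun i _ => ?_
                split_ifs <;> first | rfl | omega
          · calc
              _ ≤ ∑ j : Fin n, (if (j : ℕ) < q then ∑ i, a i j else 0) := by
                refine Finset.sum_le_sum fun j _ => ?_
                split_ifs
                · exact Finset.sum_le_sum fun i _ => by split_ifs <;> simp [ha]
                · exact le_rfl
              _ ≤ _ := hcol q
              _ = _ := by
                refine Finset.sum_congr rfl fun i _ => ?_
                split_ifs <;> first | rfl | omega
      refine le_trans (le_of_eq ?_) (inner.trans (le_of_eq ?_))
      · simp only [Finset.mul_sum]
        rw [Finset.sum_comm]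
        refine Finset.sum_congr rfl fun i _ => ?_
        split_ifs <;> simp
      · simp
  simpa [Finset.mul_sum, mul_assoc] using outer

/-- Averaging an antitone nonnegative sequence by a doubly stochastic array decreases all initial
partial sums. -/
theorem partial_sum_doublyStochastic_le {n : ℕ} (d : Fin n → Fin n → ℝ) (z : Fin n → ℝ)
    (hd : ∀ i j, 0 ≤ d i j) (hrow : ∀ i, ∑ j, d i j = 1) (hcol : ∀ j, ∑ i, d i j = 1)
    (hz : Antitone z) (hz0 : ∀ i, 0 ≤ z i) (p : ℕ) :
    ∑ i : Fin n, (if (i : ℕ) < p then ∑ j, d i j * z j else 0)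
      ≤ ∑ i : Fin n, (if (i : ℕ) < p then z i else 0) := by
  have key := sum_sum_mul_le_of_partial_sums_le d (fun i => if (i : ℕ) < p then 1 else 0) z
    (fun _ => 1) hd
    (fun i j hij => by
      have : (i : ℕ) ≤ j := hij
      dsimp only
      split_ifs <;> first | omega | simp)
    (fun i => by split_ifs <;> simp) hz hz0 (by simp [hrow]) (by simp [hcol])
  refine le_trans (le_of_eq ?_) (key.trans (le_of_eq ?_))
  · refine Finset.sum_congr rfl fun i _ => ?_
    split_ifs <;> simp [mul_comm]
  · simp

namespace Matrix

/-- A Hermitian matrix is unitarily diagonalised by any ordering of the eigenvalues of a Hermitian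
matrix with the same characteristic polynomial. -/
theorem IsHermitian.exists_unitary_diagonal {n : ℕ} {A B : Matrix (Fin n) (Fin n) ℂ}
    (hA : A.IsHermitian) (hB : B.IsHermitian) (hAB : A.charpoly = B.charpoly)
    (z : Fin n → ℝ) (e : Equiv.Perm (Fin n)) (hz : ∀ k, z k = hA.eigenvalues (e k)) :
    ∃ U : Matrix (Fin n) (Fin n) ℂ, U * Uᴴ = 1 ∧ Uᴴ * U = 1 ∧
      B = U * diagonal (fun k => (z k : ℂ)) * Uᴴ := by
  have heig := (hA.eigenvalues_eq_eigenvalues_iff hB).2 hAB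
  set V : Matrix (Fin n) (Fin n) ℂ := hB.eigenvectorUnitary.1 with hV
  have hV1 : V * Vᴴ = 1 := Unitary.mul_star_self_of_mem hB.eigenvectorUnitary.2
  have hV2 : Vᴴ * V = 1 := Unitary.star_mul_self_of_mem hB.eigenvectorUnitary.2
  have hdiag : diagonal (fun k => (z k : ℂ)) =
      (diagonal (fun k => (hB.eigenvalues k : ℂ))).submatrix e e := by
    rw [submatrix_diagonal_equiv]
    congr 1
    funext k
    simp [hz, heig]
  refine ⟨V.submatrix id e, ?_, ?_, ?_⟩
  · rw [conjTranspose_submatrix, submatrix_mul_equiv, hV1, submatrix_id_id]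
  · rw [conjTranspose_submatrix, ← submatrix_mul _ _ _ _ _ Function.bijective_id, hV2,
      submatrix_one_equiv]
  · rw [conjTranspose_submatrix, hdiag, submatrix_mul_equiv, submatrix_mul_equiv, submatrix_id_id]
    exact hB.spectral_theorem

theorem sum_normSq_row {n : ℕ} {U : Matrix (Fin n) (Fin n) ℂ} (hU : U * Uᴴ = 1) (i : Fin n) :
    ∑ j, Complex.normSq (U i j) = 1 := by
  have h := congrFun (congrFun hU i) i
  simp only [mul_apply, conjTranspose_apply, one_apply_eq, Complex.star_def,
    Complex.mul_conj] at h
  exact_mod_cast h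

theorem sum_normSq_col {n : ℕ} {U : Matrix (Fin n) (Fin n) ℂ} (hU : Uᴴ * U = 1) (j : Fin n) :
    ∑ i, Complex.normSq (U i j) = 1 := by
  simpa [conjTranspose_apply] using
    sum_normSq_row (U := Uᴴ) (by rwa [conjTranspose_conjTranspose]) j

/-- Ky Fan's inequality for the squared row norms of a matrix `M`, where `M * Mᴴ` has
eigenvalues `z`. -/
theorem partial_sum_normSq_row_le {n : ℕ} {A M : Matrix (Fin n) (Fin n) ℂ}
    (hA : A.IsHermitian) (hAM : A.charpoly = (M * Mᴴ).charpoly)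
    (z : Fin n → ℝ) (hz : Antitone z) (hz0 : ∀ i, 0 ≤ z i) (e : Equiv.Perm (Fin n))
    (hze : ∀ k, z k = hA.eigenvalues (e k)) (p : ℕ) :
    ∑ i : Fin n, (if (i : ℕ) < p then ∑ j, Complex.normSq (M i j) else 0)
      ≤ ∑ i : Fin n, (if (i : ℕ) < p then z i else 0) := by
  obtain ⟨U, hU1, hU2, hM⟩ := hA.exists_unitary_diagonal (isHermitian_mul_conjTranspose_self M)
    hAM z e hze
  have hrow (i : Fin n) :
      ∑ j, Complex.normSq (M i j) = ∑ j, Complex.normSq (U i j) * z j := by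
    have h := congrFun (congrFun hM i) i
    rw [mul_apply, mul_apply] at h
    simp only [mul_diagonal, conjTranspose_apply, Complex.star_def,
      mul_right_comm _ (Complex.ofReal _), Complex.mul_conj] at h
    exact_mod_cast h
  simp only [hrow]
  exact partial_sum_doublyStochastic_le _ z (fun _ _ => Complex.normSq_nonneg _)
    (sum_normSq_row hU1) (sum_normSq_col hU2) hz hz0 p

theorem trace_conjTranspose_diagonal_mul_diagonal {n : ℕ} (M : Matrix (Fin n) (Fin n) ℂ)
    (x y : Fin n → ℝ) :
    (trace (Mᴴ * diagonal (fun k => (x k : ℂ)) * M * diagonal (fun k => (y k : ℂ)))).re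
      = ∑ i, ∑ j, x i * y j * Complex.normSq (M i j) := by
  have h : trace (Mᴴ * diagonal (fun k => (x k : ℂ)) * M * diagonal (fun k => (y k : ℂ)))
      = ((∑ i, ∑ j, x i * y j * Complex.normSq (M i j) : ℝ) : ℂ) := by
    rw [Finset.sum_comm]
    push_cast
    simp only [trace, diag_apply, mul_diagonal]
    refine Finset.sum_congr rfl fun j _ => ?_
    rw [mul_apply, Finset.sum_mul]
    refine Finset.sum_congr rfl fun i _ => ?_
    rw [mul_diagonal, conjTranspose_apply, Complex.star_def, ← Complex.mul_conj]
    ring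
  rw [h, Complex.ofReal_re]

end Matrix

/-- Two-RIS Von Neumann-type bound: for `n × n` complex matrices `H 0, H 1, H 2` with
singular values `σ l 0 ≥ σ l 1 ≥ … ≥ 0` (in decreasing order, where the `σ l k` squared
are the eigenvalues of `H l * (H l)ᴴ`), and any unitary `Φ₁, Φ₂`, the squared Frobenius
norm of the cascaded matrix `H₂ Φ₂ H₁ Φ₁ H₀` is at most `∑ k, σ₀ₖ² σ₁ₖ² σ₂ₖ²`. -/
theorem cascaded_two_ris_trace_bound (n : ℕ)
    (H : Fin 3 → Matrix (Fin n) (Fin n) ℂ)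
    (σ : Fin 3 → Fin n → ℝ)
    (hσ_nonneg : ∀ l k, 0 ≤ σ l k)
    (hσ_dec : ∀ l, Antitone (σ l))
    (hσ_sv : ∀ l, ∃ e : Equiv.Perm (Fin n), ∀ k,
      (σ l k) ^ 2 =
        (Matrix.posSemidef_self_mul_conjTranspose (H l)).isHermitian.eigenvalues (e k))
    (Φ₁ Φ₂ : Matrix (Fin n) (Fin n) ℂ)
    (hΦ₁ : Φ₁ * Φ₁.conjTranspose = 1) (hΦ₂ : Φ₂ * Φ₂.conjTranspose = 1) :
    Complex.re (Matrix.trace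
        ((H 2 * Φ₂ * H 1 * Φ₁ * H 0) * (H 2 * Φ₂ * H 1 * Φ₁ * H 0).conjTranspose))
      ≤ ∑ k, (σ 0 k) ^ 2 * (σ 1 k) ^ 2 * (σ 2 k) ^ 2 := by
  have hH (l) : (H l * (H l).conjTranspose).IsHermitian :=
    Matrix.isHermitian_mul_conjTranspose_self (H l)
  have hsq (l) : Antitone fun k => σ l k ^ 2 :=
    fun i j hij => pow_le_pow_left₀ (hσ_nonneg l j) (hσ_dec l hij) 2
  have hsq0 (l k) : 0 ≤ σ l k ^ 2 := sq_nonneg _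
  obtain ⟨e₀, he₀⟩ := hσ_sv 0
  obtain ⟨e₁, he₁⟩ := hσ_sv 1
  obtain ⟨e₂, he₂⟩ := hσ_sv 2
  obtain ⟨V, hV1, -, hV⟩ := (hH 0).exists_unitary_diagonal (hH 0) rfl _ e₀ he₀
  obtain ⟨U, hU1, -, hU⟩ := (hH 2).exists_unitary_diagonal
    (Matrix.isHermitian_conjTranspose_mul_self (H 2)) (Matrix.charpoly_mul_comm _ _) _ e₂ he₂
  set M := U.conjTranspose * Φ₂ * H 1 * Φ₁ * V with hM
  have hchar : (H 1 * (H 1).conjTranspose).charpoly = (M * M.conjTranspose).charpoly := by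
    have hMM : M * M.conjTranspose = (U.conjTranspose * Φ₂) *
        (H 1 * (H 1).conjTranspose * (Φ₂.conjTranspose * U)) := by
      calc
        _ = U.conjTranspose * Φ₂ * H 1 * (Φ₁ * (V * V.conjTranspose) * Φ₁.conjTranspose) *
            (H 1).conjTranspose * Φ₂.conjTranspose * U := by
          simp only [hM, Matrix.conjTranspose_mul, Matrix.conjTranspose_conjTranspose,
            Matrix.mul_assoc]
        _ = _ := by
          rw [hV1, Matrix.mul_one, hΦ₁, Matrix.mul_one]
          simp only [Matrix.mul_assoc]
    have hW : Φ₂.conjTranspose * U * (U.conjTranspose * Φ₂) = 1 := by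
      rw [Matrix.mul_assoc, ← Matrix.mul_assoc U, hU1, Matrix.one_mul,
        mul_eq_one_comm.1 hΦ₂]
    rw [hMM, Matrix.charpoly_mul_comm (U.conjTranspose * Φ₂), Matrix.mul_assoc (H 1 * _), hW, Matrix.mul_one]
  have htrace : Matrix.trace
      ((H 2 * Φ₂ * H 1 * Φ₁ * H 0) * (H 2 * Φ₂ * H 1 * Φ₁ * H 0).conjTranspose) =
      Matrix.trace (M.conjTranspose * Matrix.diagonal (fun k => ((σ 2 k ^ 2 : ℝ) : ℂ)) * M *
        Matrix.diagonal (fun k => ((σ 0 k ^ 2 : ℝ) : ℂ))) := by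
    set Y := Φ₂ * H 1 * Φ₁ with hY
    calc
      _ = Matrix.trace (H 2 * (Y * (H 0 * (H 0).conjTranspose) * Y.conjTranspose *
          (H 2).conjTranspose)) := by
        simp only [hY, Matrix.conjTranspose_mul, Matrix.mul_assoc]
      _ = Matrix.trace (Y * (H 0 * (H 0).conjTranspose) * Y.conjTranspose *
          ((H 2).conjTranspose * H 2)) := by
        rw [Matrix.trace_mul_comm]
        simp only [Matrix.mul_assoc]
      _ = Matrix.trace ((Y * V * Matrix.diagonal (fun k => ((σ 0 k ^ 2 : ℝ) : ℂ))) *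
          (V.conjTranspose * Y.conjTranspose * U *
            Matrix.diagonal (fun k => ((σ 2 k ^ 2 : ℝ) : ℂ)) * U.conjTranspose)) := by
        rw [hV, hU]
        simp only [Matrix.mul_assoc]
      _ = _ := by
        rw [Matrix.trace_mul_comm]
        simp only [hM, hY, Matrix.conjTranspose_mul, Matrix.conjTranspose_conjTranspose,
          Matrix.mul_assoc]
  rw [htrace, Matrix.trace_conjTranspose_diagonal_mul_diagonal]
  have hcol (p : ℕ) := Matrix.partial_sum_normSq_row_le (M := M.conjTranspose) (hH 1)
    (by rw [Matrix.conjTranspose_conjTranspose, hchar, Matrix.charpoly_mul_comm]) _ (hsq 1)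
    (hsq0 1) e₁ he₁ p
  simp only [Matrix.conjTranspose_apply, Complex.star_def, Complex.normSq_conj] at hcol
  refine (sum_sum_mul_le_of_partial_sums_le _ _ _ _ (fun _ _ => Complex.normSq_nonneg _) (hsq 2)
    (hsq0 2) (hsq 0) (hsq0 0)
    (Matrix.partial_sum_normSq_row_le (hH 1) hchar _ (hsq 1) (hsq0 1) e₁ he₁) hcol).trans_eq ?_
  exact Finset.sum_congr rfl fun k _ => by ring
end

section
/- Let L ≥ 1 and let H₀, H₁, …, H_L be n×n complex matrices, where for each l the singular values of H_l in decreasing order are σ_{l,1} ≥ … ≥ σ_{l,n} ≥ 0. Then for all n×n unitary matrices Φ₁, …, Φ_L, the cascaded matrix H_cas = H_L Φ_L H_{L−1} Φ_{L−1} ⋯ H₁ Φ₁ H₀ satisfies Tr(H_cas H_casᴴ) ≤ Σ_{k=1}^{n} Π_{l=0}^{L} σ_{l,k}². (Generalization of the paper's cascaded trace bound to an arbitrary number L of cascaded RISs.) -/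
open ComplexOrder

/-- The cascaded channel matrix `H_L * Φ_L * H_{L-1} * Φ_{L-1} * ⋯ * H_1 * Φ_1 * H_0`,
where `Φ i` (for `i : Fin L`) is the phase shift matrix of the `(i+1)`-th RIS. -/
noncomputable def cascade (n : ℕ) :
    (L : ℕ) → (Fin (L + 1) → Matrix (Fin n) (Fin n) ℂ) →
      (Fin L → Matrix (Fin n) (Fin n) ℂ) → Matrix (Fin n) (Fin n) ℂ
  | 0, H, _ => H 0
  | (L + 1), H, Φ =>
      H (Fin.last (L + 1)) * Φ (Fin.last L) *
        cascade n L (fun i => H i.castSucc) (fun i => Φ i.castSucc)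

open scoped Matrix Matrix.Norms.L2Operator in
/-- The entries of a complex matrix are bounded by its operator norm. -/
theorem Matrix.norm_apply_le_l2_opNorm {m n : Type*} [Fintype m] [Fintype n] [DecidableEq n]
    (C : Matrix m n ℂ) (i : m) (j : n) : ‖C i j‖ ≤ ‖C‖ := by
  have h := C.l2_opNorm_mulVec (EuclideanSpace.single j 1)
  have hle := (PiLp.norm_apply_le ((EuclideanSpace.equiv m ℂ).symm
    (C *ᵥ (EuclideanSpace.single j (1 : ℂ)).ofLp)) i).trans h
  simpa using hle

/-- The diagonal projection onto the coordinates `k ≤ r`. -/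
def truncation {n : ℕ} (r : Fin n) : Matrix (Fin n) (Fin n) ℂ :=
  Matrix.diagonal fun k => if k ≤ r then 1 else 0

open scoped Matrix Matrix.Norms.L2Operator in
/-- `M` is a nonnegative combination of matrices `A * truncation r * B` with `A`, `B`
contractions, in which the terms with `k ≤ r` have total weight `s k`. -/
def IsLayered {n : ℕ} (M : Matrix (Fin n) (Fin n) ℂ) (s : Fin n → ℝ) : Prop :=
  ∃ (ι : Type) (_ : Fintype ι) (c : ι → ℝ) (r : ι → Fin n) (A B : ι → Matrix (Fin n) (Fin n) ℂ),
    (∀ j, 0 ≤ c j) ∧ (∀ j, ‖A j‖ ≤ 1) ∧ (∀ j, ‖B j‖ ≤ 1) ∧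
    M = ∑ j, (c j : ℂ) • (A j * truncation (r j) * B j) ∧
    ∀ k, s k = ∑ j, if k ≤ r j then c j else 0

section

open scoped Matrix Matrix.Norms.L2Operator

variable {n : ℕ}

theorem norm_truncation_le (r : Fin n) : ‖truncation r‖ ≤ 1 := by
  rw [truncation, Matrix.l2_opNorm_diagonal, pi_norm_le_iff_of_nonneg zero_le_one]
  intro k
  split_ifs <;> simp

theorem conjTranspose_truncation (r : Fin n) : (truncation r)ᴴ = truncation r := by
  rw [truncation, Matrix.diagonal_conjTranspose]
  congr 1
  ext k
  simp only [Pi.star_apply]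
  split_ifs <;> simp

theorem norm_mul_le_one {A B : Matrix (Fin n) (Fin n) ℂ} (hA : ‖A‖ ≤ 1) (hB : ‖B‖ ≤ 1) :
    ‖A * B‖ ≤ 1 :=
  (norm_mul_le A B).trans (mul_le_one₀ hA (norm_nonneg _) hB)

theorem norm_le_one_of_mul_conjTranspose {A : Matrix (Fin n) (Fin n) ℂ} (h : ‖A * Aᴴ‖ ≤ 1) :
    ‖A‖ ≤ 1 := by
  have hle := Matrix.l2_opNorm_conjTranspose_mul_self Aᴴ
  rw [Matrix.conjTranspose_conjTranspose, Matrix.l2_opNorm_conjTranspose] at hle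
  nlinarith [norm_nonneg A]

theorem norm_one_le_one : ‖(1 : Matrix (Fin n) (Fin n) ℂ)‖ ≤ 1 := by
  rw [← Matrix.diagonal_one, Matrix.l2_opNorm_diagonal, pi_norm_le_iff_of_nonneg zero_le_one]
  simp

/-- The trace of `A * truncation r * B` is at most the rank of the truncation. -/
theorem re_trace_truncation_le {A B : Matrix (Fin n) (Fin n) ℂ} (hA : ‖A‖ ≤ 1) (hB : ‖B‖ ≤ 1)
    (r : Fin n) :
    (Matrix.trace (A * truncation r * B)).re ≤ ∑ k, if k ≤ r then (1 : ℝ) else 0 := by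
  rw [mul_assoc, Matrix.trace_mul_comm, mul_assoc, Matrix.trace, Complex.re_sum]
  refine Finset.sum_le_sum fun k _ => ?_
  rw [Matrix.diag_apply, truncation, Matrix.diagonal_mul]
  split_ifs
  · rw [one_mul]
    exact (Complex.re_le_norm _).trans
      ((Matrix.norm_apply_le_l2_opNorm _ k k).trans (norm_mul_le_one hB hA))
  · simp

namespace IsLayered

variable {M N : Matrix (Fin n) (Fin n) ℂ} {s t : Fin n → ℝ}

theorem re_trace_le (h : IsLayered M s) : (Matrix.trace M).re ≤ ∑ k, s k := by
  obtain ⟨ι, _, c, r, A, B, hc, hA, hB, rfl, hs⟩ := h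
  simp_rw [hs]
  rw [Finset.sum_comm, Matrix.trace_sum, Complex.re_sum]
  refine Finset.sum_le_sum fun j _ => ?_
  rw [Matrix.trace_smul, smul_eq_mul, Complex.re_ofReal_mul]
  refine (mul_le_mul_of_nonneg_left (re_trace_truncation_le (hA j) (hB j) (r j)) (hc j)).trans
    (le_of_eq ?_)
  simp only [Finset.mul_sum, mul_ite, mul_one, mul_zero]

theorem conjTranspose (h : IsLayered M s) : IsLayered Mᴴ s := by
  obtain ⟨ι, _, c, r, A, B, hc, hA, hB, rfl, hs⟩ := h
  refine ⟨ι, inferInstance, c, r, fun j => (B j)ᴴ, fun j => (A j)ᴴ, hc,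
    fun j => (Matrix.l2_opNorm_conjTranspose _).trans_le (hB j),
    fun j => (Matrix.l2_opNorm_conjTranspose _).trans_le (hA j), ?_, hs⟩
  simp [Matrix.conjTranspose_sum, Matrix.conjTranspose_smul, conjTranspose_truncation, mul_assoc]

theorem mul_contraction (h : IsLayered M s) {C : Matrix (Fin n) (Fin n) ℂ} (hC : ‖C‖ ≤ 1) :
    IsLayered (M * C) s := by
  obtain ⟨ι, _, c, r, A, B, hc, hA, hB, rfl, hs⟩ := h
  refine ⟨ι, inferInstance, c, r, A, fun j => B j * C, hc, hA,
    fun j => norm_mul_le_one (hB j) hC, ?_, hs⟩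
  simp [Finset.sum_mul, mul_assoc]

theorem mul (hM : IsLayered M s) (hN : IsLayered N t) :
    IsLayered (M * N) (fun k => s k * t k) := by
  obtain ⟨ι, _, c, r, A, B, hc, hA, hB, rfl, hs⟩ := hM
  obtain ⟨κ, _, d, q, C, D, hd, hC, hD, rfl, ht⟩ := hN
  have key : ∀ p : ι × κ, ∃ E F : Matrix (Fin n) (Fin n) ℂ, ‖E‖ ≤ 1 ∧ ‖F‖ ≤ 1 ∧
      A p.1 * truncation (r p.1) * B p.1 * (C p.2 * truncation (q p.2) * D p.2) =
        E * truncation (min (r p.1) (q p.2)) * F := by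
    rintro ⟨i, j⟩
    rcases le_total (r i) (q j) with h | h
    · refine ⟨A i, B i * (C j * truncation (q j) * D j), hA i, norm_mul_le_one (hB i)
        (norm_mul_le_one (norm_mul_le_one (hC j) (norm_truncation_le _)) (hD j)), ?_⟩
      simp only [min_eq_left h, mul_assoc]
    · refine ⟨A i * truncation (r i) * B i * C j, D j, norm_mul_le_one (norm_mul_le_one
        (norm_mul_le_one (hA i) (norm_truncation_le _)) (hB i)) (hC j), hD j, ?_⟩
      simp only [min_eq_right h, mul_assoc]
  choose E F hE hF hEF using key
  refine ⟨ι × κ, inferInstance, fun p => c p.1 * d p.2, fun p => min (r p.1) (q p.2), E, F,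
    fun p => mul_nonneg (hc _) (hd _), hE, hF, ?_, fun k => ?_⟩
  · simp_rw [← hEF]
    rw [Fintype.sum_prod_type, Finset.sum_mul_sum]
    simp only [smul_mul_smul_comm, Complex.ofReal_mul]
  · simp only
    rw [hs, ht, Fintype.sum_prod_type, Finset.sum_mul_sum]
    refine Finset.sum_congr rfl fun i _ => Finset.sum_congr rfl fun j _ => ?_
    simp only [le_min_iff, ite_and]
    split_ifs <;> simp

end IsLayered

/-- A nonnegative decreasing sequence is a sum of nonnegative multiples of initial segments. -/
theorem exists_eq_sum_initial_segments {s : Fin n → ℝ} (h0 : ∀ k, 0 ≤ s k) (hs : Antitone s) :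
    ∃ c : Fin n → ℝ, (∀ r, 0 ≤ c r) ∧ ∀ k, s k = ∑ r, if k ≤ r then c r else 0 := by
  let f : ℕ → ℝ := fun i => if h : i < n then s ⟨i, h⟩ else 0
  refine ⟨fun r => f r - f (r + 1), fun r => ?_, fun k => ?_⟩
  · simp only [f, r.2, dif_pos, sub_nonneg]
    split_ifs with h
    · exact hs (Fin.mk_le_mk.2 (Nat.le_succ _))
    · exact h0 _
  · have h1 := Fin.sum_univ_eq_sum_range
      (fun i => if (k : ℕ) ≤ i then f i - f (i + 1) else 0) n
    simp only [Fin.le_def]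
    rw [h1, ← Finset.sum_filter]
    have h2 : (Finset.range n).filter (fun i => (k : ℕ) ≤ i) = Finset.Ico (k : ℕ) n := by
      ext i
      simp [and_comm]
    rw [h2]
    have h3 := Finset.sum_Ico_sub f k.2.le
    rw [← neg_inj, ← Finset.sum_neg_distrib]
    simp only [neg_sub, h3]
    simp [f]

theorem isLayered_mul_diagonal_mul {A B : Matrix (Fin n) (Fin n) ℂ} (hA : ‖A‖ ≤ 1) (hB : ‖B‖ ≤ 1)
    {s : Fin n → ℝ} (h0 : ∀ k, 0 ≤ s k) (hs : Antitone s) :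
    IsLayered (A * Matrix.diagonal (fun k => (s k : ℂ)) * B) s := by
  obtain ⟨c, hc, hsc⟩ := exists_eq_sum_initial_segments h0 hs
  refine ⟨Fin n, inferInstance, c, id,
    fun _ => A, fun _ => B, hc, fun _ => hA, fun _ => hB, ?_, hsc⟩
  have hD : Matrix.diagonal (fun k => (s k : ℂ)) = ∑ r, (c r : ℂ) • truncation r := by
    ext i j
    rw [Matrix.sum_apply]
    by_cases hij : i = j
    · subst hij
      simp [truncation, hsc i, apply_ite Complex.ofReal]
    · simp [truncation, hij]
  rw [hD, Finset.mul_sum, Finset.sum_mul]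
  simp

/-- A form of the singular value decomposition. -/
theorem exists_eq_mul_diagonal_mul (H : Matrix (Fin n) (Fin n) ℂ) {s : Fin n → ℝ}
    (h : ∃ e : Equiv.Perm (Fin n), ∀ k, s k ^ 2 =
      (Matrix.posSemidef_self_mul_conjTranspose H).isHermitian.eigenvalues (e k)) :
    ∃ A B : Matrix (Fin n) (Fin n) ℂ, ‖A‖ ≤ 1 ∧ ‖B‖ ≤ 1 ∧
      H = A * Matrix.diagonal (fun k => (s k : ℂ)) * B := by
  obtain ⟨e, he⟩ := h
  set hH := (Matrix.posSemidef_self_mul_conjTranspose H).isHermitian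
  let U : Matrix (Fin n) (Fin n) ℂ := hH.eigenvectorUnitary
  have hUU : U * Uᴴ = 1 := Unitary.coe_mul_star_self hH.eigenvectorUnitary
  have hdiag : Uᴴ * (H * Hᴴ) * U = Matrix.diagonal (fun k => (hH.eigenvalues k : ℂ)) := by
    have := hH.conjStarAlgAut_star_eigenvectorUnitary
    rw [Unitary.conjStarAlgAut_star_apply] at this
    exact this
  let V := U.submatrix id e
  have hVV : V * Vᴴ = 1 := by
    rw [Matrix.conjTranspose_submatrix, Matrix.submatrix_mul_equiv, hUU, Matrix.submatrix_id_id]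
  let W := Vᴴ * H
  have hWW : W * Wᴴ = Matrix.diagonal (fun k => (s k : ℂ) ^ 2) := by
    have hW : W * Wᴴ = (Uᴴ * (H * Hᴴ) * U).submatrix e e := by
      have hWV : W * Wᴴ = Vᴴ * (H * Hᴴ) * V := by simp [W, mul_assoc]
      rw [hWV]
      rfl
    rw [hW, hdiag, Matrix.submatrix_diagonal_equiv]
    congr 1
    ext k
    simp only [Function.comp_apply, ← he]
    push_cast
    rfl
  have hrow : ∀ k, s k = 0 → W k = 0 := by
    intro k hk
    have h1 := congrFun (congrFun hWW k) k
    rw [Matrix.diagonal_apply_eq, hk] at h1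
    exact dotProduct_self_star_eq_zero.1 (h1.trans (by simp))
  refine ⟨V, Matrix.diagonal (fun k => ((s k : ℂ))⁻¹) * W,
    norm_le_one_of_mul_conjTranspose (hVV ▸ norm_one_le_one),
    norm_le_one_of_mul_conjTranspose ?_, ?_⟩
  · rw [Matrix.conjTranspose_mul, mul_assoc, ← mul_assoc W, hWW, Matrix.diagonal_conjTranspose,
      Matrix.diagonal_mul_diagonal, Matrix.diagonal_mul_diagonal, Matrix.l2_opNorm_diagonal,
      pi_norm_le_iff_of_nonneg zero_le_one]
    intro k
    by_cases hk : s k = 0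
    · simp [hk]
    · have hk0 : (s k : ℂ) ≠ 0 := by exact_mod_cast hk
      refine le_of_eq ?_
      rw [Pi.star_apply, star_inv₀, Complex.star_def, Complex.conj_ofReal]
      field_simp
      simp
  · have hDW : Matrix.diagonal (fun k => (s k : ℂ)) *
        (Matrix.diagonal (fun k => ((s k : ℂ))⁻¹) * W) = W := by
      ext k j
      rw [Matrix.diagonal_mul, Matrix.diagonal_mul]
      by_cases hk : s k = 0
      · simp [hrow k hk]
      · have hk0 : (s k : ℂ) ≠ 0 := by exact_mod_cast hk
        field_simp
    rw [mul_assoc, hDW, ← mul_assoc, hVV, one_mul]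

theorem isLayered_of_singular_values (H : Matrix (Fin n) (Fin n) ℂ) {s : Fin n → ℝ}
    (h0 : ∀ k, 0 ≤ s k) (hs : Antitone s)
    (h : ∃ e : Equiv.Perm (Fin n), ∀ k, s k ^ 2 =
      (Matrix.posSemidef_self_mul_conjTranspose H).isHermitian.eigenvalues (e k)) :
    IsLayered H s := by
  obtain ⟨A, B, hA, hB, hAB⟩ := exists_eq_mul_diagonal_mul H h
  rw [hAB]
  exact isLayered_mul_diagonal_mul hA hB h0 hs

theorem isLayered_cascade : ∀ (L : ℕ) (H : Fin (L + 1) → Matrix (Fin n) (Fin n) ℂ)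
    (σ : Fin (L + 1) → Fin n → ℝ) (Φ : Fin L → Matrix (Fin n) (Fin n) ℂ),
    (∀ l, IsLayered (H l) (σ l)) → (∀ i, ‖Φ i‖ ≤ 1) →
    IsLayered (cascade n L H Φ) (fun k => ∏ l, σ l k)
  | 0, H, σ, Φ, hH, _ => by simpa [cascade] using hH 0
  | L + 1, H, σ, Φ, hH, hΦ => by
    have ih := isLayered_cascade L (fun i => H i.castSucc) (fun i => σ i.castSucc)
      (fun i => Φ i.castSucc) (fun l => hH _) (fun i => hΦ _)
    have h := ((hH (Fin.last (L + 1))).mul_contraction (hΦ (Fin.last L))).mul ih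
    simp_rw [Fin.prod_univ_castSucc (n := L + 1), mul_comm _ (σ (Fin.last (L + 1)) _)]
    exact h

end

/-- Cascaded Von Neumann-type bound for `L ≥ 1` RISs: for `n × n` complex matrices
`H 0, …, H L` with singular values `σ l 0 ≥ σ l 1 ≥ … ≥ 0` in decreasing order
(the `σ l k` squared being the eigenvalues of `H l * (H l)ᴴ`), and any unitary phase
shift matrices `Φ 1, …, Φ L`, the squared Frobenius norm of the cascaded matrix
satisfies `Tr(H_cas H_casᴴ) ≤ ∑ k, ∏ l, σ l k ^ 2`. -/
theorem cascaded_ris_trace_bound (n L : ℕ) (hL : 1 ≤ L)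
    (H : Fin (L + 1) → Matrix (Fin n) (Fin n) ℂ)
    (σ : Fin (L + 1) → Fin n → ℝ)
    (hσ_nonneg : ∀ l k, 0 ≤ σ l k)
    (hσ_dec : ∀ l, Antitone (σ l))
    (hσ_sv : ∀ l, ∃ e : Equiv.Perm (Fin n), ∀ k,
      (σ l k) ^ 2 =
        (Matrix.posSemidef_self_mul_conjTranspose (H l)).isHermitian.eigenvalues (e k))
    (Φ : Fin L → Matrix (Fin n) (Fin n) ℂ)
    (hΦ : ∀ i, Φ i * (Φ i).conjTranspose = 1) :
    Complex.re (Matrix.trace (cascade n L H Φ * (cascade n L H Φ).conjTranspose))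
      ≤ ∑ k, ∏ l, (σ l k) ^ 2 := by
  have h := isLayered_cascade L H σ Φ
    (fun l => isLayered_of_singular_values (H l) (hσ_nonneg l) (hσ_dec l) (hσ_sv l))
    (fun i => norm_le_one_of_mul_conjTranspose ((hΦ i).symm ▸ norm_one_le_one))
  refine (h.mul h.conjTranspose).re_trace_le.trans (le_of_eq ?_)
  simp_rw [← sq, Finset.prod_pow]
end

section
/- Let L ≥ 1 and let H₀, H₁, …, H_L be n×n complex matrices with singular value decompositions H_l = U_l S_l V_lᴴ, where each U_l, V_l is unitary and each S_l = diag(σ_{l,1},…,σ_{l,n}) is diagonal with nonnegative entries in decreasing order. Define the unitary phase shift matrices Φ_i = V_i U_{i−1}ᴴ for i = 1,…,L. Then the cascaded matrix H_cas = H_L Φ_L H_{L−1} Φ_{L−1} ⋯ H₁ Φ₁ H₀ equals U_L (S_L S_{L−1} ⋯ S₁ S₀) V₀ᴴ; in particular Tr(H_cas H_casᴴ) = Σ_{k=1}^{n} Π_{l=0}^{L} σ_{l,k}², so the choice Φ_i = V_i U_{i−1}ᴴ attains the Von Neumann-type upper bound. (This is the paper's closed-form optimal cascaded RIS configuration, equations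 (17)–(18).) -/
/-- With the phase shifts `V (j + 1) * (U j)ᴴ` the unitary factors of consecutive channels cancel,
and only the outermost ones survive. -/
theorem cascade_eq_of_svd (n L : ℕ)
    (H U V : Fin (L + 1) → Matrix (Fin n) (Fin n) ℂ) (d : Fin (L + 1) → Fin n → ℂ)
    (hU : ∀ l, (U l).conjTranspose * U l = 1)
    (hV : ∀ l, (V l).conjTranspose * V l = 1)
    (hH : ∀ l, H l = U l * Matrix.diagonal (d l) * (V l).conjTranspose)
    (Φ : Fin L → Matrix (Fin n) (Fin n) ℂ)
    (hΦ : ∀ j : Fin L, Φ j = V j.succ * (U j.castSucc).conjTranspose) :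
    cascade n L H Φ =
      U (Fin.last L) * Matrix.diagonal (fun k => ∏ l, d l k) * (V 0).conjTranspose := by
  induction L with
  | zero => simp [cascade, hH]
  | succ L ih =>
    rw [cascade, ih (fun i => H i.castSucc) (fun i => U i.castSucc) (fun i => V i.castSucc)
      (fun i => d i.castSucc) (fun _ => hU _) (fun _ => hV _) (fun _ => hH _) _
      (fun j => hΦ j.castSucc), hH, hΦ, Fin.succ_last]
    have hdiag : Matrix.diagonal (fun k => ∏ l, d l k) = Matrix.diagonal (d (Fin.last (L + 1))) *
        Matrix.diagonal (fun k => ∏ l : Fin (L + 1), d l.castSucc k) := by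
      simp only [Matrix.diagonal_mul_diagonal, Fin.prod_univ_castSucc (n := L + 1), mul_comm]
    rw [hdiag, Fin.castSucc_zero]
    simp only [Matrix.mul_assoc]
    rw [← Matrix.mul_assoc (V (Fin.last (L + 1))).conjTranspose, hV, Matrix.one_mul,
      ← Matrix.mul_assoc (U (Fin.last L).castSucc).conjTranspose, hU, Matrix.one_mul]

/-- The squared Frobenius norm of `U * diagonal d * Vᴴ` depends only on `d`. -/
theorem trace_svd_mul_conjTranspose {n : ℕ} {U V : Matrix (Fin n) (Fin n) ℂ} (d : Fin n → ℂ)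
    (hU : U.conjTranspose * U = 1) (hV : V.conjTranspose * V = 1) :
    Matrix.trace ((U * Matrix.diagonal d * V.conjTranspose) *
      (U * Matrix.diagonal d * V.conjTranspose).conjTranspose) = ∑ k, d k * star (d k) := by
  simp only [Matrix.conjTranspose_mul, Matrix.conjTranspose_conjTranspose, Matrix.mul_assoc]
  rw [← Matrix.mul_assoc V.conjTranspose, hV, Matrix.one_mul, Matrix.trace_mul_comm]
  simp only [Matrix.mul_assoc]
  rw [hU, Matrix.mul_one, Matrix.diagonal_conjTranspose, Matrix.diagonal_mul_diagonal,
    Matrix.trace_diagonal]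
  rfl

/-- Optimal cascaded RIS configuration: for SVDs `H l = U l * S l * (V l)ᴴ` with
`S l = diag (σ l)` (nonnegative, decreasing), the phase shifts `Φ_i = V_i U_{i-1}ᴴ`
(`i = 1, …, L`, i.e. `Φ j = V (j+1) * (U j)ᴴ` for `j : Fin L`) give
`H_cas = U_L (S_L ⋯ S_0) V_0ᴴ`, whence `Tr(H_cas H_casᴴ) = ∑ k, ∏ l, σ l k ^ 2`,
attaining the Von Neumann-type upper bound. -/
theorem cascaded_ris_optimal_phase (n L : ℕ) (hL : 1 ≤ L)
    (H U V : Fin (L + 1) → Matrix (Fin n) (Fin n) ℂ)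
    (σ : Fin (L + 1) → Fin n → ℝ)
    (hσ_nonneg : ∀ l k, 0 ≤ σ l k)
    (hσ_dec : ∀ l, Antitone (σ l))
    (hU : ∀ l, U l * (U l).conjTranspose = 1)
    (hV : ∀ l, V l * (V l).conjTranspose = 1)
    (hSVD : ∀ l, H l = U l * Matrix.diagonal (fun k => (σ l k : ℂ)) * (V l).conjTranspose)
    (Φ : Fin L → Matrix (Fin n) (Fin n) ℂ)
    (hΦ : ∀ j : Fin L, Φ j = V j.succ * (U j.castSucc).conjTranspose) :
    cascade n L H Φ =
        U (Fin.last L) * Matrix.diagonal (fun k => ∏ l, (σ l k : ℂ)) *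
          (V 0).conjTranspose ∧
      Matrix.trace (cascade n L H Φ * (cascade n L H Φ).conjTranspose)
        = ∑ k, ∏ l, ((σ l k : ℂ)) ^ 2 := by
  have hU' l := mul_eq_one_comm.mp (hU l)
  have hV' l := mul_eq_one_comm.mp (hV l)
  have hcas := cascade_eq_of_svd n L H U V (fun l k => (σ l k : ℂ)) hU' hV' hSVD Φ hΦ
  refine ⟨hcas, ?_⟩
  rw [hcas, trace_svd_mul_conjTranspose _ (hU' _) (hV' _)]
  simp [sq, Finset.prod_mul_distrib]
end

section
/- Let L ≥ 1, let ρ > 0 be a real number (ρ = P_t/M, the per-antenna transmit power of the uniform power allocation precoder Q = ρ·I), and let H₀, …, H_L be n×n complex matrices with singular value decompositions H_l = U_l S_l V_lᴴ, S_l = diag(σ_{l,1},…,σ_{l,n}) nonnegative. With the phase shift matrices Φ_i = V_i U_{i−1}ᴴ for i = 1,…,L and H_cas = H_L Φ_L ⋯ H₁ Φ₁ H₀, the achievable capacity satisfies log₂ det(I + ρ · H_cas H_casᴴ) = Σ_{k=1}^{n} log₂(1 + ρ · Π_{l=0}^{L} σ_{l,k}²). (Capacity formula of Theorem 1 of the paper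 for optimally configured cascaded BD-RISs under uniform power allocation.) -/
open Matrix in
/-- Phase shifts `V_i U_{i-1}ᴴ` align the singular bases, so that the cascade has a singular
value decomposition whose singular values are the products of those of the factors. -/
theorem cascade_eq_mul_diagonal_mul (n L : ℕ)
    (H U V : Fin (L + 1) → Matrix (Fin n) (Fin n) ℂ) (s : Fin (L + 1) → Fin n → ℂ)
    (hU : ∀ l, U l * (U l)ᴴ = 1) (hV : ∀ l, V l * (V l)ᴴ = 1)
    (hH : ∀ l, H l = U l * diagonal (s l) * (V l)ᴴ)
    (Φ : Fin L → Matrix (Fin n) (Fin n) ℂ)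
    (hΦ : ∀ j : Fin L, Φ j = V j.succ * (U j.castSucc)ᴴ) :
    cascade n L H Φ = U (Fin.last L) * diagonal (fun k => ∏ l, s l k) * (V 0)ᴴ := by
  induction L with
  | zero => simp [cascade, hH]
  | succ L ih =>
    have hcas := ih (fun i => H i.castSucc) (fun i => U i.castSucc) (fun i => V i.castSucc)
      (fun i => s i.castSucc) (fun _ => hU _) (fun _ => hV _) (fun _ => hH _)
      (fun i => Φ i.castSucc) (fun j => by simpa using hΦ j.castSucc)
    have hU' : (U (Fin.last L).castSucc)ᴴ * U (Fin.last L).castSucc = 1 :=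
      mul_eq_one_comm.mp (hU _)
    have hV' : (V (Fin.last (L + 1)))ᴴ * V (Fin.last (L + 1)) = 1 :=
      mul_eq_one_comm.mp (hV _)
    have hdiag : diagonal (fun k => ∏ l, s l k) =
        diagonal (s (Fin.last (L + 1))) * diagonal (fun k => ∏ l : Fin (L + 1), s l.castSucc k) := by
      rw [diagonal_mul_diagonal]
      congr 1
      ext k
      rw [Fin.prod_univ_castSucc, mul_comm]
    rw [cascade, hcas, hH, hΦ, hdiag, Fin.succ_last, Fin.castSucc_zero]
    calc
      _ = U (Fin.last (L + 1)) * diagonal (s (Fin.last (L + 1))) *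
          ((V (Fin.last (L + 1)))ᴴ * V (Fin.last (L + 1))) *
          ((U (Fin.last L).castSucc)ᴴ * U (Fin.last L).castSucc) *
          diagonal (fun k => ∏ l : Fin (L + 1), s l.castSucc k) * (V 0)ᴴ := by
        simp only [Matrix.mul_assoc]
      _ = _ := by
        rw [hU', hV']
        simp only [Matrix.mul_assoc, Matrix.one_mul]

open Matrix in
theorem det_one_add_smul_mul_conjTranspose_of_svd {ι : Type*} [Fintype ι] [DecidableEq ι]
    (c : ℂ) (U V : Matrix ι ι ℂ) (d : ι → ℂ) (hU : U * Uᴴ = 1) (hV : V * Vᴴ = 1) :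
    (1 + c • ((U * diagonal d * Vᴴ) * (U * diagonal d * Vᴴ)ᴴ)).det =
      ∏ k, (1 + c * (d k * star (d k))) := by
  have hV' : Vᴴ * V = 1 := mul_eq_one_comm.mp hV
  have hdiag : diagonal (fun k => 1 + c * (d k * star (d k))) =
      1 + c • (diagonal d * diagonal (star d)) := by
    rw [diagonal_mul_diagonal, ← diagonal_one, ← diagonal_smul, diagonal_add]
    rfl
  have hconj : 1 + c • ((U * diagonal d * Vᴴ) * (U * diagonal d * Vᴴ)ᴴ) =
      U * diagonal (fun k => 1 + c * (d k * star (d k))) * Uᴴ := by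
    calc
      _ = 1 + c • (U * diagonal d * (Vᴴ * V) * diagonal (star d) * Uᴴ) := by
        simp only [conjTranspose_mul, conjTranspose_conjTranspose, diagonal_conjTranspose,
          Matrix.mul_assoc]
      _ = _ := by
        rw [hV', hdiag, Matrix.mul_one, Matrix.mul_add, Matrix.add_mul, Matrix.mul_one, hU,
          Matrix.mul_smul, Matrix.smul_mul]
        simp only [Matrix.mul_assoc]
  rw [hconj, det_mul_right_comm, hU, Matrix.one_mul, det_diagonal]

/-- Capacity of optimally configured cascaded BD-RISs with uniform power allocation
(`Q = ρ I`, `ρ = P_t / M > 0`): with SVDs `H l = U l * diag (σ l) * (V l)ᴴ` and phase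
shifts `Φ_i = V_i U_{i-1}ᴴ`, one has
`log₂ det(I + ρ H_cas H_casᴴ) = ∑ k, log₂ (1 + ρ ∏ l, σ l k ^ 2)`. -/
theorem cascaded_ris_upa_capacity (n L : ℕ) (hL : 1 ≤ L) (ρ : ℝ) (hρ : 0 < ρ)
    (H U V : Fin (L + 1) → Matrix (Fin n) (Fin n) ℂ)
    (σ : Fin (L + 1) → Fin n → ℝ)
    (hσ_nonneg : ∀ l k, 0 ≤ σ l k)
    (hU : ∀ l, U l * (U l).conjTranspose = 1)
    (hV : ∀ l, V l * (V l).conjTranspose = 1)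
    (hSVD : ∀ l, H l = U l * Matrix.diagonal (fun k => (σ l k : ℂ)) * (V l).conjTranspose)
    (Φ : Fin L → Matrix (Fin n) (Fin n) ℂ)
    (hΦ : ∀ j : Fin L, Φ j = V j.succ * (U j.castSucc).conjTranspose) :
    Real.logb 2 (Complex.re
        ((1 + (ρ : ℂ) • (cascade n L H Φ * (cascade n L H Φ).conjTranspose)).det))
      = ∑ k, Real.logb 2 (1 + ρ * ∏ l, (σ l k) ^ 2) := by
  have hdet : (1 + (ρ : ℂ) • (cascade n L H Φ * (cascade n L H Φ).conjTranspose)).det =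
      ((∏ k, (1 + ρ * ∏ l, (σ l k) ^ 2) : ℝ) : ℂ) := by
    rw [cascade_eq_mul_diagonal_mul n L H U V (fun l k => (σ l k : ℂ)) hU hV hSVD Φ hΦ,
      det_one_add_smul_mul_conjTranspose_of_svd _ _ _ _ (hU _) (hV _)]
    push_cast
    refine Finset.prod_congr rfl fun k _ => ?_
    rw [star_prod, ← Finset.prod_mul_distrib]
    simp [sq]
  rw [hdet, Complex.ofReal_re, Real.logb_prod]
  intro k _
  positivity
end
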